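/- arXiv:1605.02843 — 3 statements merged into one kernel-verified Lean document; each statement's English description precedes it below -/
import Mathlib

section
/- Let M ≥ 0 be a fixed natural number and let f : ℝ → ℝ be infinitely differentiable. Then ∫₀¹ f(t) dt = lim_{L→∞} Σ_{ℓ=1}^{L} Σ_{m=0}^{M} ( ((-1)^m + 1) / ( (2L)^(m+1) (m+1)! ) ) · f^(m)( (ℓ - 1/2)/L ), where the limit is taken over positive integers L. -/
open Filter Topology

/-- Midpoint Riemann sums of a continuous function on `[0, 1]` converge to its integral. -/
theorem tendsto_midpoint_riemann_sum {g : ℝ → ℝ} (hg : Continuous g) :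
    Tendsto (fun L : ℕ => (1 / (L : ℝ)) *
        ∑ ℓ ∈ Finset.Icc 1 L, g (((ℓ : ℝ) - 1 / 2) / (L : ℝ)))
      atTop (𝓝 (∫ t in (0 : ℝ)..1, g t)) := by
  rw [Metric.tendsto_atTop]
  intro ε hε
  have huc : UniformContinuousOn g (Set.Icc 0 1) :=
    isCompact_Icc.uniformContinuousOn_of_continuous hg.continuousOn
  obtain ⟨δ, hδ, h⟩ := Metric.uniformContinuousOn_iff.1 huc (ε / 2) (half_pos hε)
  obtain ⟨N, hN⟩ := exists_nat_gt (1 / δ)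
  refine ⟨N + 1, fun L hL => ?_⟩
  have hL0 : (0 : ℝ) < L := by exact_mod_cast (by omega : 0 < L)
  have hLδ : 1 / (L : ℝ) < δ := by
    rw [div_lt_comm₀ hL0 hδ]
    have : (N : ℝ) ≤ L := by exact_mod_cast (by omega : N ≤ L)
    linarith
  have hsplit : ∫ t in (0 : ℝ)..1, g t =
      ∑ k ∈ Finset.range L, ∫ t in ((k : ℝ) / L)..(((k + 1 : ℕ) : ℝ) / L), g t := by
    rw [intervalIntegral.sum_integral_adjacent_intervals (a := fun k : ℕ => (k : ℝ) / L)
      (fun k _ => hg.intervalIntegrable _ _)]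
    simp [hL0.ne']
  have hsum : ∑ ℓ ∈ Finset.Icc 1 L, g (((ℓ : ℝ) - 1 / 2) / (L : ℝ)) =
      ∑ k ∈ Finset.range L, g (((k : ℝ) + 1 / 2) / L) := by
    rw [Finset.range_eq_Ico, ← Finset.Ico_add_one_right_eq_Icc,
      Finset.sum_Ico_eq_sum_range, ← Finset.range_eq_Ico]
    refine Finset.sum_congr (by simp) fun k _ => ?_
    push_cast
    congr 2
    ring
  rw [hsum, hsplit, Finset.mul_sum, Real.dist_eq, ← Finset.sum_sub_distrib]
  have hterm : ∀ k ∈ Finset.range L, |1 / (L : ℝ) * g (((k : ℝ) + 1 / 2) / L) -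
      ∫ t in ((k : ℝ) / L)..(((k + 1 : ℕ) : ℝ) / L), g t| ≤ ε / 2 * (1 / L) := by
    intro k hk
    have hk1 : (k : ℝ) + 1 ≤ L := by exact_mod_cast Finset.mem_range.1 hk
    have hk0 : (0 : ℝ) ≤ k := k.cast_nonneg
    have hlen : (((k + 1 : ℕ) : ℝ) / L) - (k : ℝ) / L = 1 / L := by
      push_cast
      ring
    have hint : 1 / (L : ℝ) * g (((k : ℝ) + 1 / 2) / L) -
        ∫ t in ((k : ℝ) / L)..(((k + 1 : ℕ) : ℝ) / L), g t =
        ∫ t in ((k : ℝ) / L)..(((k + 1 : ℕ) : ℝ) / L), (g (((k : ℝ) + 1 / 2) / L) - g t) := by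
      rw [intervalIntegral.integral_sub intervalIntegrable_const (hg.intervalIntegrable _ _),
        intervalIntegral.integral_const, hlen, smul_eq_mul]
    rw [hint, ← Real.norm_eq_abs]
    refine (intervalIntegral.norm_integral_le_of_norm_le_const (C := ε / 2) ?_).trans_eq ?_
    · intro t ht
      rw [Set.uIoc_of_le (by linarith [hlen, one_div_pos.2 hL0])] at ht
      obtain ⟨ht1, ht2⟩ := ht
      have hkL : (0 : ℝ) ≤ (k : ℝ) / L := by positivity
      have hkL1 : (((k + 1 : ℕ) : ℝ) / L) ≤ 1 := by
        rw [div_le_one hL0]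
        exact_mod_cast hk1
      have hmid : ((k : ℝ) + 1 / 2) / L = (k : ℝ) / L + 1 / L / 2 := by ring
      have hpos := one_div_pos.2 hL0
      rw [← dist_eq_norm]
      refine (h _ ⟨by positivity, by linarith⟩ _ ⟨by linarith, by linarith⟩ ?_).le
      rw [Real.dist_eq, abs_lt]
      constructor <;> linarith
    · rw [hlen, abs_of_pos (one_div_pos.2 hL0)]
  calc _ ≤ ∑ k ∈ Finset.range L, ε / 2 * (1 / (L : ℝ)) :=
        (Finset.abs_sum_le_sum_abs _ _).trans (Finset.sum_le_sum hterm)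
    _ = ε / 2 := by
        rw [Finset.sum_const, Finset.card_range, nsmul_eq_mul]
        field_simp
    _ < ε := half_lt_self hε

theorem integral_eq_lim_derivs (M : ℕ) (f : ℝ → ℝ) (hf : ContDiff ℝ (⊤ : ℕ∞) f) :
    Tendsto
      (fun L : ℕ =>
        ∑ ℓ ∈ Finset.Icc 1 L, ∑ m ∈ Finset.range (M + 1),
          (((-1 : ℝ) ^ m + 1) / ((2 * (L : ℝ)) ^ (m + 1) * ((m + 1).factorial : ℝ))) *
            iteratedDeriv m f (((ℓ : ℝ) - 1 / 2) / (L : ℝ)))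
      atTop (𝓝 (∫ t in (0 : ℝ)..1, f t)) := by
  have hcont (m : ℕ) : Continuous (iteratedDeriv m f) :=
    hf.continuous_iteratedDeriv m (by exact_mod_cast le_top)
  have hlim (m : ℕ) : Tendsto (fun L : ℕ => (((-1 : ℝ) ^ m + 1) /
      (2 ^ (m + 1) * ((m + 1).factorial : ℝ))) * ((1 / (L : ℝ)) ^ m * ((1 / (L : ℝ)) *
        ∑ ℓ ∈ Finset.Icc 1 L, iteratedDeriv m f (((ℓ : ℝ) - 1 / 2) / (L : ℝ)))))
      atTop (𝓝 ((((-1 : ℝ) ^ m + 1) / (2 ^ (m + 1) * ((m + 1).factorial : ℝ))) *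
        (0 ^ m * ∫ t in (0 : ℝ)..1, iteratedDeriv m f t))) :=
    ((tendsto_one_div_atTop_nhds_zero_nat.pow m).mul
      (tendsto_midpoint_riemann_sum (hcont m))).const_mul _
  have htotal := tendsto_finsetSum (Finset.range (M + 1)) fun m _ => hlim m
  rw [Finset.sum_range_succ'] at htotal
  norm_num at htotal
  convert htotal using 2 with L
  rw [Finset.sum_comm]
  refine Finset.sum_congr rfl fun m _ => ?_
  rw [← Finset.mul_sum, mul_pow, pow_succ (L : ℝ) m]
  simp only [div_eq_mul_inv, mul_inv]
  ring_nf
end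

section
/- Let M ≥ 0 be a fixed natural number and x a real number. Then arctan(x) = lim_{L→∞} 2 · Σ_{ℓ=1}^{L} Σ_{m=1}^{⌊M/2⌋+1} ( 1 / ( (2L)^(2m-1) (2m-1)! ) ) · [ ∂^(2m-2)/∂t^(2m-2) ( x / (1 + x² t²) ) evaluated at t = (ℓ - 1/2)/L ], where the limit is taken over positive integers L. -/
open Filter Topology

/-- Midpoint Riemann sums of a continuous function on `[0, 1]` converge to its integral. -/
theorem tendsto_midpoint_sum {f : ℝ → ℝ} (hf : Continuous f) :
    Tendsto (fun L : ℕ => (∑ ℓ ∈ Finset.Icc 1 L, f (((ℓ : ℝ) - 1 / 2) / (L : ℝ))) / (L : ℝ))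
      atTop (𝓝 (∫ t in (0 : ℝ)..1, f t)) := by
  have huc : UniformContinuousOn f (Set.Icc 0 1) :=
    isCompact_Icc.uniformContinuousOn_of_continuous hf.continuousOn
  rw [Metric.tendsto_atTop]
  intro ε hε
  obtain ⟨δ, hδ, h⟩ := Metric.uniformContinuousOn_iff.1 huc (ε / 2) (by positivity)
  obtain ⟨N, hN⟩ := exists_nat_gt (1 / δ)
  refine ⟨N + 1, fun L hL => ?_⟩
  have hL0 : (0 : ℝ) < L := by exact_mod_cast (by omega : 0 < L)
  have hLδ : 1 / (L : ℝ) < δ := by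
    rw [div_lt_comm₀ hL0 hδ]
    exact hN.trans (by exact_mod_cast hL)
  have hint : ∫ t in (0 : ℝ)..1, f t
      = ∑ k ∈ Finset.range L, ∫ t in ((k : ℝ) / L)..(((k + 1 : ℕ) : ℝ) / L), f t := by
    rw [intervalIntegral.sum_integral_adjacent_intervals (a := fun k : ℕ => (k : ℝ) / L)
      fun k _ => hf.intervalIntegrable _ _]
    simp [hL0.ne']
  have hsum : (∑ ℓ ∈ Finset.Icc 1 L, f (((ℓ : ℝ) - 1 / 2) / (L : ℝ))) / (L : ℝ)
      = ∑ k ∈ Finset.range L,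
        ∫ _ in ((k : ℝ) / L)..(((k + 1 : ℕ) : ℝ) / L), f (((k : ℝ) + 1 / 2) / L) := by
    rw [Finset.sum_div, Finset.range_eq_Ico,
      ← Finset.Ico_add_one_right_eq_Icc, Finset.sum_Ico_eq_sum_range, Finset.range_eq_Ico]
    refine Finset.sum_congr (by simp) fun k _ => ?_
    rw [intervalIntegral.integral_const, smul_eq_mul]
    have e : (((1 + k : ℕ) : ℝ) - 1 / 2) = (k : ℝ) + 1 / 2 := by push_cast; ring
    rw [e]
    push_cast
    field_simp
    ring
  rw [hint, hsum, dist_eq_norm, ← Finset.sum_sub_distrib]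
  calc _ ≤ ∑ k ∈ Finset.range L, (ε / 2) * (1 / L) := by
        refine norm_sum_le_of_le _ fun k hk => ?_
        rw [Finset.mem_range] at hk
        have hk' : (k : ℝ) + 1 ≤ L := by exact_mod_cast hk
        have hk0 : (0 : ℝ) ≤ k := k.cast_nonneg
        rw [← intervalIntegral.integral_sub intervalIntegrable_const
          (hf.intervalIntegrable _ _)]
        have hw : |((k + 1 : ℕ) : ℝ) / L - (k : ℝ) / L| = 1 / L := by
          rw [← sub_div, Nat.cast_add_one, add_sub_cancel_left, abs_of_pos (by positivity)]
        rw [← hw]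
        refine intervalIntegral.norm_integral_le_of_norm_le_const fun t ht => ?_
        rw [Set.uIoc_of_le (by gcongr; simp)] at ht
        obtain ⟨h1, h2⟩ := ht
        rw [div_lt_iff₀ hL0] at h1
        rw [le_div_iff₀ hL0] at h2
        push_cast at h2
        rw [← dist_eq_norm]
        refine (h _ ⟨by positivity, ?_⟩ t ⟨?_, ?_⟩ (lt_of_le_of_lt ?_ hLδ)).le
        · rw [div_le_one hL0]; linarith
        · by_contra! hc
          nlinarith
        · by_contra! hc
          nlinarith
        · have e : ((k : ℝ) + 1 / 2) / L - t = ((k : ℝ) + 1 / 2 - t * L) / L := by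
            field_simp
          rw [Real.dist_eq, e, abs_div, abs_of_pos hL0]
          gcongr
          rw [abs_le]
          constructor <;> linarith
    _ = ε / 2 := by
        rw [Finset.sum_const, Finset.card_range, nsmul_eq_mul]
        field_simp
    _ < ε := by linarith

theorem contDiff_div_one_add_sq_mul_sq (x : ℝ) (n : ℕ) :
    ContDiff ℝ n (fun t : ℝ => x / (1 + x ^ 2 * t ^ 2)) := by
  refine contDiff_const.div (by fun_prop) fun t => ?_
  positivity

theorem integral_div_one_add_sq_mul_sq (x : ℝ) :
    ∫ t in (0 : ℝ)..1, x / (1 + x ^ 2 * t ^ 2) = Real.arctan x := by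
  rw [intervalIntegral.integral_eq_sub_of_hasDerivAt (f := fun t => Real.arctan (x * t))]
  · simp
  · intro t _
    have h := ((hasDerivAt_id' t).const_mul x).arctan
    rwa [mul_one, mul_pow, one_div_mul_eq_div] at h
  · exact (contDiff_div_one_add_sq_mul_sq x 0).continuous.intervalIntegrable _ _

theorem arctan_eq_lim_even_derivs (M : ℕ) (x : ℝ) :
    Tendsto
      (fun L : ℕ =>
        2 * ∑ ℓ ∈ Finset.Icc 1 L, ∑ m ∈ Finset.Icc 1 (M / 2 + 1),
          (1 / ((2 * (L : ℝ)) ^ (2 * m - 1) * ((2 * m - 1).factorial : ℝ))) *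
            iteratedDeriv (2 * m - 2) (fun t : ℝ => x / (1 + x ^ 2 * t ^ 2))
              (((ℓ : ℝ) - 1 / 2) / (L : ℝ)))
      atTop (𝓝 (Real.arctan x)) := by
  set f : ℝ → ℝ := fun t => x / (1 + x ^ 2 * t ^ 2) with hf
  have hterm : ∀ m ∈ Finset.Icc 1 (M / 2 + 1), Tendsto (fun L : ℕ =>
      ((2 * (L : ℝ))⁻¹ ^ (2 * m - 2) * (1 / ((2 * m - 1).factorial : ℝ))) *
        ((∑ ℓ ∈ Finset.Icc 1 L, iteratedDeriv (2 * m - 2) f (((ℓ : ℝ) - 1 / 2) / (L : ℝ))) / L))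
      atTop (𝓝 (if m = 1 then Real.arctan x else 0)) := by
    intro m hm
    have hm1 := (Finset.mem_Icc.1 hm).1
    have hS := tendsto_midpoint_sum
      ((contDiff_div_one_add_sq_mul_sq x (2 * m - 2)).continuous_iteratedDeriv' (2 * m - 2))
    split_ifs with h
    · subst h
      simpa [integral_div_one_add_sq_mul_sq] using hS
    · have hinv : Tendsto (fun L : ℕ => (2 * (L : ℝ))⁻¹) atTop (𝓝 0) :=
        (tendsto_natCast_atTop_atTop.const_mul_atTop two_pos).inv_tendsto_atTop
      have hpow := ((hinv.pow (2 * m - 2)).mul_const (1 / ((2 * m - 1).factorial : ℝ))).mul hS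
      rwa [zero_pow (by omega), zero_mul, zero_mul] at hpow
  have hlim := tendsto_finsetSum _ hterm
  rw [Finset.sum_ite_eq', if_pos (by simp)] at hlim
  refine hlim.congr' ?_
  filter_upwards [eventually_gt_atTop 0] with L hL
  have hL0 : (L : ℝ) ≠ 0 := by exact_mod_cast hL.ne'
  rw [Finset.sum_comm, Finset.mul_sum]
  refine Finset.sum_congr rfl fun m hm => ?_
  have hm1 := (Finset.mem_Icc.1 hm).1
  obtain ⟨n, rfl⟩ : ∃ n, m = n + 1 := ⟨m - 1, by omega⟩
  rw [← Finset.mul_sum, show 2 * (n + 1) - 1 = 2 * n + 1 by omega,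
    show 2 * (n + 1) - 2 = 2 * n by omega, inv_pow, pow_succ]
  field_simp
end

section
/- Let M ≥ 0 be a fixed natural number. Then π = lim_{L→∞} 4 i · Σ_{ℓ=1}^{L} Σ_{m=1}^{⌊M/2⌋+1} ( 1/(2m-1) ) · ( 1/((2ℓ-1) + 2 i L)^(2m-1) - 1/((2ℓ-1) - 2 i L)^(2m-1) ), where i is the imaginary unit, the limit is taken over positive integers L, and the convergence is in ℂ to the real number π embedded in ℂ. -/
open Filter Topology Complex

/-- One-cell error bound for the Riemann sums of `1 / (1 + x ^ 2)`. -/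
theorem abs_arctan_sub_sub_le {a b x : ℝ} (hab : a < b) (hax : a ≤ x) (hxb : x ≤ b) :
    |(b - a) / (1 + x ^ 2) - (Real.arctan b - Real.arctan a)| ≤ (b - a) ^ 2 := by
  obtain ⟨y, ⟨hay, hyb⟩, hy⟩ := exists_hasDerivAt_eq_slope Real.arctan (fun t => 1 / (1 + t ^ 2))
    hab Real.continuous_arctan.continuousOn (fun t _ => Real.hasDerivAt_arctan t)
  have hba : 0 < b - a := sub_pos.2 hab
  have hy' : Real.arctan b - Real.arctan a = (b - a) * (1 / (1 + y ^ 2)) := by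
    rw [hy]
    field_simp
  have hx0 : 0 < 1 + x ^ 2 := by positivity
  have hy0 : 0 < 1 + y ^ 2 := by positivity
  have key : (b - a) / (1 + x ^ 2) - (b - a) * (1 / (1 + y ^ 2)) =
      (b - a) * ((y - x) * ((x + y) / ((1 + x ^ 2) * (1 + y ^ 2)))) := by
    field_simp
    ring
  have hxy : |y - x| ≤ b - a := abs_le.2 ⟨by linarith, by linarith⟩
  have hfac : |(x + y) / ((1 + x ^ 2) * (1 + y ^ 2))| ≤ 1 := by
    rw [abs_div, abs_of_pos (mul_pos hx0 hy0), div_le_one (mul_pos hx0 hy0)]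
    refine abs_le.2 ⟨?_, ?_⟩ <;>
      nlinarith [sq_nonneg (x - 1), sq_nonneg (y - 1), sq_nonneg (x + 1), sq_nonneg (y + 1),
        sq_nonneg (x * y)]
  rw [hy', key, abs_mul, abs_mul, abs_of_pos hba, sq (b - a)]
  refine mul_le_mul_of_nonneg_left ?_ hba.le
  calc |y - x| * |(x + y) / ((1 + x ^ 2) * (1 + y ^ 2))| ≤ (b - a) * 1 := by gcongr
    _ = b - a := mul_one _

/-- The midpoint Riemann sums of `4 / (1 + x ^ 2)` on `[0, 1]` converge to `π`. -/
theorem tendsto_midpoint_sum_pi :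
    Tendsto (fun L : ℕ => ∑ ℓ ∈ Finset.Icc 1 L, 16 * (L : ℝ) / ((2 * ℓ - 1) ^ 2 + 4 * (L : ℝ) ^ 2))
      atTop (𝓝 Real.pi) := by
  rw [tendsto_iff_norm_sub_tendsto_zero]
  refine squeeze_zero' (.of_forall fun _ => norm_nonneg _) ?_
    (tendsto_const_div_atTop_nhds_zero_nat (4 : ℝ))
  filter_upwards [eventually_gt_atTop 0] with L hL
  have hL' : (0 : ℝ) < L := Nat.cast_pos.2 hL
  have htel : Real.pi =
      ∑ k ∈ Finset.range L, 4 * (Real.arctan ((k + 1 : ℕ) / L) - Real.arctan (k / L)) := by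
    rw [← Finset.mul_sum, Finset.sum_range_sub (fun k : ℕ => Real.arctan (k / L)),
      div_self hL'.ne', Real.arctan_one]
    simp
    ring
  have hshift : ∑ ℓ ∈ Finset.Icc 1 L, 16 * (L : ℝ) / ((2 * ℓ - 1) ^ 2 + 4 * (L : ℝ) ^ 2) =
      ∑ k ∈ Finset.range L, 16 * (L : ℝ) / ((2 * (k + 1 : ℕ) - 1) ^ 2 + 4 * (L : ℝ) ^ 2) := by
    rw [Finset.range_eq_Ico,
      Finset.sum_Ico_add' (fun j : ℕ => 16 * (L : ℝ) / ((2 * j - 1) ^ 2 + 4 * (L : ℝ) ^ 2))]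
    rfl
  rw [hshift]
  rw [htel]
  rw [← Finset.sum_sub_distrib]
  refine (norm_sum_le_of_le _ (n := fun _ => 4 / (L : ℝ) ^ 2) fun k _ => ?_).trans_eq ?_
  · have h := abs_arctan_sub_sub_le (a := k / L) (b := (k + 1 : ℕ) / L)
      (x := (2 * (k + 1 : ℕ) - 1) / (2 * L)) (by gcongr; simp)
      (by rw [div_le_div_iff₀ hL' (by positivity)]; push_cast; nlinarith)
      (by rw [div_le_div_iff₀ (by positivity) hL']; push_cast; nlinarith)
    have hd : ((k + 1 : ℕ) / L - k / L : ℝ) = 1 / L := by push_cast; ring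
    rw [hd] at h
    have he : 16 * (L : ℝ) / ((2 * (k + 1 : ℕ) - 1) ^ 2 + 4 * (L : ℝ) ^ 2) =
        4 * (1 / L / (1 + ((2 * (k + 1 : ℕ) - 1) / (2 * L)) ^ 2)) := by
      have : 0 < (2 * ((k + 1 : ℕ) : ℝ) - 1) ^ 2 + 4 * (L : ℝ) ^ 2 := by positivity
      field_simp
      ring
    rw [he, ← mul_sub, norm_mul, Real.norm_eq_abs, Real.norm_eq_abs, abs_of_pos four_pos]
    calc _ ≤ 4 * (1 / (L : ℝ)) ^ 2 := by gcongr
      _ = 4 / (L : ℝ) ^ 2 := by ring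
  · rw [Finset.sum_const, Finset.card_range, nsmul_eq_mul]
    field_simp

/-- The contribution of the first order `m = 1` converges to `π`. -/
theorem tendsto_first_order_sum_pi :
    Tendsto
      (fun L : ℕ => ∑ ℓ ∈ Finset.Icc 1 L,
        4 * I * (1 / ((2 * (ℓ : ℂ) - 1) + 2 * I * (L : ℂ)) -
          1 / ((2 * (ℓ : ℂ) - 1) - 2 * I * (L : ℂ))))
      atTop (𝓝 ((Real.pi : ℝ) : ℂ)) := by
  refine ((continuous_ofReal.tendsto Real.pi).comp tendsto_midpoint_sum_pi).congr fun L => ?_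
  rw [Function.comp_apply, ofReal_sum]
  refine Finset.sum_congr rfl fun ℓ hℓ => ?_
  have hL : L ≠ 0 := by
    have := Finset.mem_Icc.1 hℓ
    omega
  have hp : (2 * (ℓ : ℂ) - 1) + 2 * I * (L : ℂ) ≠ 0 := fun h => hL <| by
    simpa using congrArg im h
  have hm : (2 * (ℓ : ℂ) - 1) - 2 * I * (L : ℂ) ≠ 0 := fun h => hL <| by
    simpa using congrArg im h
  have hprod : (2 * (ℓ : ℂ) - 1) ^ 2 + 4 * (L : ℂ) ^ 2 =
      ((2 * (ℓ : ℂ) - 1) + 2 * I * (L : ℂ)) * ((2 * (ℓ : ℂ) - 1) - 2 * I * (L : ℂ)) := by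
    linear_combination 4 * (L : ℂ) ^ 2 * I_sq
  push_cast
  rw [hprod, div_sub_div _ _ hp hm, mul_div_assoc']
  congr 1
  linear_combination 16 * (L : ℂ) * I_sq

/-- The inverse of a large power of a number with imaginary part at least `L` is `O(L⁻²)`. -/
theorem norm_one_div_pow_le {z : ℂ} {L : ℝ} {n : ℕ} (hL : 1 ≤ L) (hz : L ≤ |z.im|) (hn : 2 ≤ n) :
    ‖1 / z ^ n‖ ≤ 1 / L ^ 2 := by
  rw [norm_div, norm_one, norm_pow]
  have hLz : L ≤ ‖z‖ := hz.trans (abs_im_le_norm z)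
  refine one_div_le_one_div_of_le (by positivity) ?_
  calc L ^ 2 ≤ ‖z‖ ^ 2 := by gcongr
    _ ≤ ‖z‖ ^ n := pow_le_pow_right₀ (hL.trans hLz) hn

/-- The contributions of the higher orders `m ≥ 2` vanish in the limit. -/
theorem tendsto_higher_order_sum_zero (c : ℂ) {n : ℕ} (hn : 2 ≤ n) :
    Tendsto
      (fun L : ℕ => ∑ ℓ ∈ Finset.Icc 1 L,
        c * (1 / ((2 * (ℓ : ℂ) - 1) + 2 * I * (L : ℂ)) ^ n -
          1 / ((2 * (ℓ : ℂ) - 1) - 2 * I * (L : ℂ)) ^ n))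
      atTop (𝓝 0) := by
  refine squeeze_zero_norm' ?_ (tendsto_const_div_atTop_nhds_zero_nat (2 * ‖c‖))
  filter_upwards [eventually_gt_atTop 0] with L hL
  have hL1 : (1 : ℝ) ≤ L := Nat.one_le_cast.2 hL
  have habs : |2 * (L : ℝ)| = 2 * L := abs_of_nonneg (by positivity)
  refine (norm_sum_le_of_le _ (n := fun _ => ‖c‖ * (1 / (L : ℝ) ^ 2 + 1 / (L : ℝ) ^ 2))
    fun ℓ _ => ?_).trans_eq ?_
  · rw [norm_mul]
    gcongr
    refine (norm_sub_le _ _).trans (add_le_add ?_ ?_) <;>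
      refine norm_one_div_pow_le hL1 ?_ hn <;> simp <;> linarith
  · rw [Finset.sum_const, Nat.card_Icc, nsmul_eq_mul, Nat.add_sub_cancel]
    field_simp
    ring

theorem pi_eq_lim_complex (M : ℕ) :
    Tendsto
      (fun L : ℕ =>
        4 * I * ∑ ℓ ∈ Finset.Icc 1 L, ∑ m ∈ Finset.Icc 1 (M / 2 + 1),
          (1 / (2 * (m : ℂ) - 1)) *
            (1 / ((2 * (ℓ : ℂ) - 1) + 2 * I * (L : ℂ)) ^ (2 * m - 1) -
              1 / ((2 * (ℓ : ℂ) - 1) - 2 * I * (L : ℂ)) ^ (2 * m - 1)))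
      atTop (𝓝 ((Real.pi : ℝ) : ℂ)) := by
  simp_rw [Finset.sum_comm (s := Finset.Icc 1 _) (t := Finset.Icc 1 (M / 2 + 1)),
    Finset.mul_sum, ← mul_assoc]
  have hlim : ((Real.pi : ℝ) : ℂ) =
      ∑ m ∈ Finset.Icc 1 (M / 2 + 1), if m = 1 then ((Real.pi : ℝ) : ℂ) else 0 := by
    simp
  rw [hlim]
  refine tendsto_finsetSum _ fun m hm => ?_
  obtain rfl | hm1 := eq_or_ne m 1
  · refine Eq.mp ?_ tendsto_first_order_sum_pi
    norm_num
  · rw [if_neg hm1]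
    have := Finset.mem_Icc.1 hm
    exact tendsto_higher_order_sum_zero _ (by omega)
end
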